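/- arXiv:2512.16787 — 3 statements merged into one kernel-verified Lean document; each statement's English description precedes it below -/
import Mathlib

section
/- Let 0 ≤ p ≤ q ≤ 1 with p ≠ 1, and let F₁(t) ≤ F₂(t) ≤ F₃(t) denote the ordered eigenvalues of M_β(t). Then for every λ ∈ A(M_β(p), M_β(q)): (a) 3u_β − 2F₂(q) > 0; (b) 1 − λ(2−λ) r_β(p,q) > 0, where r_β(p,q) := (F₂(p)/F₂(q))·((2u_β − F₂(p))/(2u_β − F₂(q))); (c) β₋(M_β(p), M_β(q)) = F₂(q)/F₂(p); (d) if q < 1 then β₋(M_β(p), M_β(q)) < β₊(M_β(p), M_β(q)). (Lemma 8.2.) -/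
open Matrix Set

noncomputable section

/-- `R` is a real 3×3 rotation matrix (element of SO(3)). -/
def IsSO3 (R : Matrix (Fin 3) (Fin 3) ℝ) : Prop := Rᵀ * R = 1 ∧ R.det = 1

/-- The rank-one matrix `n ⊗ n = (nᵢ nⱼ)`. -/
def outer (n : Fin 3 → ℝ) : Matrix (Fin 3) (Fin 3) ℝ := Matrix.vecMulVec n n

/-- `n` is a unit vector of `ℝ³`. -/
def unitVec (n : Fin 3 → ℝ) : Prop := n 0 ^ 2 + n 1 ^ 2 + n 2 ^ 2 = 1

/-- `α₋(F,G) = max(g₁/f₂, g₂/f₃)`. -/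
def alphaMinus (f1 f2 f3 g1 g2 g3 : ℝ) : ℝ := max (g1 / f2) (g2 / f3)

/-- `α₊(F,G) = min(g₁/f₁, g₂/f₂, g₃/f₃)`. -/
def alphaPlus (f1 f2 f3 g1 g2 g3 : ℝ) : ℝ := min (g1 / f1) (min (g2 / f2) (g3 / f3))

/-- `β₋(F,G) = max(g₁/f₁, g₂/f₂, g₃/f₃)`. -/
def betaMinus (f1 f2 f3 g1 g2 g3 : ℝ) : ℝ := max (g1 / f1) (max (g2 / f2) (g3 / f3))

/-- `β₊(F,G) = min(g₂/f₁, g₃/f₂)`. -/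
def betaPlus (f1 f2 f3 g1 g2 g3 : ℝ) : ℝ := min (g2 / f1) (g3 / f2)

/-- `A(F,G) = ([α₋,α₊] ∪ [β₋,β₊]) \ {1}` in terms of the ordered eigenvalues. -/
def setA (f1 f2 f3 g1 g2 g3 : ℝ) : Set ℝ :=
  (Set.Icc (alphaMinus f1 f2 f3 g1 g2 g3) (alphaPlus f1 f2 f3 g1 g2 g3) ∪
    Set.Icc (betaMinus f1 f2 f3 g1 g2 g3) (betaPlus f1 f2 f3 g1 g2 g3)) \ {1}

/-- Second elementary symmetric invariant `i₂(M) = ((tr M)² − tr(M²))/2`. -/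
def i2 (M : Matrix (Fin 3) (Fin 3) ℝ) : ℝ := (Matrix.trace M ^ 2 - Matrix.trace (M * M)) / 2

/-- Third elementary symmetric invariant `i₃(M) = det M`. -/
def i3 (M : Matrix (Fin 3) (Fin 3) ℝ) : ℝ := M.det

/-- `η(λ,t) = λ/(λ + t(1−λ))`. -/
def etaFun (lam t : ℝ) : ℝ := lam / (lam + t * (1 - lam))

/-- The one-parameter family `M(t) = η(λ,t) F + (1 − η(λ,t)) n⊗n`. -/
def Mcurve (F : Matrix (Fin 3) (Fin 3) ℝ) (n : Fin 3 → ℝ) (lam t : ℝ) :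
    Matrix (Fin 3) (Fin 3) ℝ :=
  etaFun lam t • F + (1 - etaFun lam t) • outer n

/-- The quadratic `b(x) = 6 s₂ x² + (s₁s₃ − 3s₂ − 4s₂²) x + 2 s₂²`. -/
def bpoly (s1 s2 s3 x : ℝ) : ℝ :=
  6 * s2 * x ^ 2 + (s1 * s3 - 3 * s2 - 4 * s2 ^ 2) * x + 2 * s2 ^ 2


/-- The block of the curve matrix: monotonicity of the eigenvalue ratios. -/
lemma core_kbounds (u x a b : ℝ) (hu : 1 / 3 < u) (hu2 : u < 1 / 2) (hx : 0 < x)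
    (hab : a ≤ b) (hs : a + b = 1 - x)
    (hp : u * (a * b) = x * (1 - 2 * u) * (3 * u - 2 * x)) :
    a < 3 * (1 - 2 * u) * x ∧ 3 * (1 - 2 * u) * x < b := by
  have h : u * ((a - 3 * (1 - 2 * u) * x) * (b - 3 * (1 - 2 * u) * x)) =
      -(2 * x ^ 2 * (1 - 2 * u) * (3 * u - 1) ^ 2) := by
    have hb : b = 1 - x - a := by linarith
    subst hb
    linear_combination hp
  have hneg : (a - 3 * (1 - 2 * u) * x) * (b - 3 * (1 - 2 * u) * x) < 0 := by
    have h1 : 0 < 2 * x ^ 2 * (1 - 2 * u) * (3 * u - 1) ^ 2 := by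
      have : 0 < 1 - 2 * u := by linarith
      have : 0 < 3 * u - 1 := by linarith
      positivity
    by_contra hc
    push Not at hc
    have : 0 ≤ u * ((a - 3 * (1 - 2 * u) * x) * (b - 3 * (1 - 2 * u) * x)) :=
      mul_nonneg (by linarith) hc
    linarith
  rcases mul_neg_iff.mp hneg with h | h
  · exfalso; linarith [h.1, h.2]
  · exact ⟨by linarith [h.1], by linarith [h.2]⟩

lemma core_mono (u x y a b a' b' : ℝ) (hu : 1 / 3 < u) (hu2 : u < 1 / 2) (hx : 0 < x)
    (hxy : x ≤ y) (hab : a ≤ b) (hs : a + b = 1 - x)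
    (hp : u * (a * b) = x * (1 - 2 * u) * (3 * u - 2 * x))
    (hab' : a' ≤ b') (hs' : a' + b' = 1 - y)
    (hp' : u * (a' * b') = y * (1 - 2 * u) * (3 * u - 2 * y)) :
    a' * x ≤ a * y ∧ b' * x ≤ b * y := by
  obtain ⟨h1, h2⟩ := core_kbounds u x a b hu hu2 hx hab hs hp
  have hy : 0 < y := by linarith
  obtain ⟨h3, h4⟩ := core_kbounds u y a' b' hu hu2 hy hab' hs' hp'
  have hu0 : u ≠ 0 := by linarith
  set k := 3 * (1 - 2 * u) with hk
  have hb : b = 1 - x - a := by linarith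
  have e1 : (b' * x - b * y) * (b' * x - a * y) = x * (y - x) * (k * y - b') := by
    apply mul_left_cancel₀ hu0
    have ha' : a' = 1 - y - b' := by linarith
    subst ha'
    subst hb
    rw [hk]
    linear_combination y ^ 2 * hp - x ^ 2 * hp'
  have e2 : (a' * x - b * y) * (a' * x - a * y) = x * (y - x) * (k * y - a') := by
    apply mul_left_cancel₀ hu0
    have hb' : b' = 1 - y - a' := by linarith
    subst hb'
    subst hb
    rw [hk]
    linear_combination y ^ 2 * hp - x ^ 2 * hp'
  have g1 : a * y < k * x * y := mul_lt_mul_of_pos_right h1 hy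
  have g2 : k * x * y < b * y := mul_lt_mul_of_pos_right h2 hy
  have g3 : a' * x < k * y * x := mul_lt_mul_of_pos_right h3 hx
  have g4 : k * y * x < b' * x := mul_lt_mul_of_pos_right h4 hx
  have hxx : 0 ≤ x * (y - x) := mul_nonneg hx.le (by linarith)
  constructor
  · by_contra hc
    push Not at hc
    have r1 : 0 ≤ x * (y - x) * (k * y - a') := mul_nonneg hxx (by linarith)
    have r2 : (a' * x - b * y) * (a' * x - a * y) < 0 :=
      mul_neg_of_neg_of_pos (by linarith) (by linarith)
    linarith
  · by_contra hc
    push Not at hc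
    have r1 : x * (y - x) * (k * y - b') ≤ 0 :=
      mul_nonpos_of_nonneg_of_nonpos hxx (by linarith)
    have r2 : 0 < (b' * x - b * y) * (b' * x - a * y) :=
      mul_pos (by linarith) (by linarith)
    linarith

lemma trace_conj_so3 (Q M : Matrix (Fin 3) (Fin 3) ℝ) (hQ : IsSO3 Q) :
    (Qᵀ * M * Q).trace = M.trace := by
  have h : Q * Qᵀ = 1 := mul_eq_one_comm.mp hQ.1
  rw [Matrix.trace_mul_comm, ← Matrix.mul_assoc, h, Matrix.one_mul]

lemma det_conj_so3 (Q M : Matrix (Fin 3) (Fin 3) ℝ) (hQ : IsSO3 Q) :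
    (Qᵀ * M * Q).det = M.det := by
  rw [Matrix.det_mul, Matrix.det_mul, Matrix.det_transpose, hQ.2]; ring

lemma det_comb (s1 s2 s3 e : ℝ) (m : Fin 3 → ℝ) (hm : unitVec m) (hm1 : m 1 = 0) :
    (e • Matrix.diagonal ![s1, s2, s3] + (1 - e) • outer m).det =
      s2 * e * (e ^ 2 * (s1 * s3) + e * (1 - e) * (s1 * m 2 ^ 2 + s3 * m 0 ^ 2)) := by
  rw [Matrix.det_fin_three]
  simp [outer, Matrix.vecMulVec_apply, hm1, Matrix.diagonal]
  ring

lemma trace_comb (s1 s2 s3 e : ℝ) (m : Fin 3 → ℝ) (hm : unitVec m)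
    (hsum : s1 + s2 + s3 = 1) :
    (e • Matrix.diagonal ![s1, s2, s3] + (1 - e) • outer m).trace = 1 := by
  unfold unitVec at hm
  rw [Matrix.trace_fin_three]
  simp [outer, Matrix.vecMulVec_apply, Matrix.diagonal]
  linear_combination e * hsum + (1 - e) * hm

set_option maxHeartbeats 1600000

theorem statement16 (s1 s2 s3 ub : ℝ)
    (hs1 : 0 < s1) (hs12 : s1 < s2) (hs23 : s2 < s3) (hsum : s1 + s2 + s3 = 1)
    (hub : bpoly s1 s2 s3 ub = 0) (hubmax : ∀ x : ℝ, bpoly s1 s2 s3 x = 0 → x ≤ ub)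
    (hub1 : 1 / 3 < ub) (hub2 : ub ≤ s3)
    (S : Matrix (Fin 3) (Fin 3) ℝ) (hS : S = Matrix.diagonal ![s1, s2, s3])
    (m : Fin 3 → ℝ) (hm : unitVec m) (hm1 : m 1 = 0)
    (R : Matrix (Fin 3) (Fin 3) ℝ) (hR : IsSO3 R)
    (heq : Rᵀ * Matrix.diagonal ![1 - 2 * ub, ub, ub] * R =
      (ub / s2) • S + (1 - ub / s2) • outer m)
    (F1 F2 F3 : ℝ → ℝ)
    (hord : ∀ t ∈ Set.Icc (0 : ℝ) 1, F1 t ≤ F2 t ∧ F2 t ≤ F3 t)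
    (heig : ∀ t ∈ Set.Icc (0 : ℝ) 1, ∃ Q : Matrix (Fin 3) (Fin 3) ℝ, IsSO3 Q ∧
      Qᵀ * Mcurve S m (ub / s2) t * Q = Matrix.diagonal ![F1 t, F2 t, F3 t])
    (hF2 : ∀ t ∈ Set.Icc (0 : ℝ) 1, F2 t = s2 * etaFun (ub / s2) t)
    (p q : ℝ) (hp : 0 ≤ p) (hpq : p ≤ q) (hq : q ≤ 1) (hp1 : p ≠ 1) :
    ∀ lam ∈ setA (F1 p) (F2 p) (F3 p) (F1 q) (F2 q) (F3 q),
      3 * ub - 2 * F2 q > 0 ∧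
      1 - lam * (2 - lam) * ((F2 p / F2 q) * ((2 * ub - F2 p) / (2 * ub - F2 q))) > 0 ∧
      betaMinus (F1 p) (F2 p) (F3 p) (F1 q) (F2 q) (F3 q) = F2 q / F2 p ∧
      (q < 1 →
        betaMinus (F1 p) (F2 p) (F3 p) (F1 q) (F2 q) (F3 q) <
          betaPlus (F1 p) (F2 p) (F3 p) (F1 q) (F2 q) (F3 q)) := by
  have hs2 : 0 < s2 := by linarith
  have hu : 0 < ub := by linarith
  have hus : s2 < ub := by
    by_contra hc
    push Not at hc
    have hb : bpoly s1 s2 s3 s2 = s2 * ((s2 - s1) * (s2 - s3)) := by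
      unfold bpoly
      have : s1 = 1 - s2 - s3 := by linarith
      subst this; ring
    have hneg : s2 * ((s2 - s1) * (s2 - s3)) < 0 :=
      mul_neg_of_pos_of_neg hs2 (mul_neg_of_pos_of_neg (by linarith) (by linarith))
    have h6 : (6 * s2) ≠ 0 := by positivity
    obtain ⟨v, hv⟩ : ∃ v, 6 * s2 * v = -(s1 * s3 - 3 * s2 - 4 * s2 ^ 2) - 6 * s2 * ub :=
      ⟨(-(s1 * s3 - 3 * s2 - 4 * s2 ^ 2) - 6 * s2 * ub) / (6 * s2), by field_simp⟩
    have hfac : ∀ x, bpoly s1 s2 s3 x = 6 * s2 * ((x - ub) * (x - v)) := by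
      intro x
      unfold bpoly at hub ⊢
      linear_combination hub + (x - ub) * hv
    have hvu : v ≤ ub := hubmax v (by rw [hfac]; ring)
    have : 0 ≤ bpoly s1 s2 s3 s2 := by
      rw [hfac]
      exact mul_nonneg (by positivity) (mul_nonneg (by linarith) (by linarith))
    linarith
  subst hS
  have hkdef : ∃ k, k = s1 * m 2 ^ 2 + s3 * m 0 ^ 2 := ⟨_, rfl⟩
  obtain ⟨k, hk⟩ := hkdef
  have hkpos : 0 < k := by
    have hm' := hm
    unfold unitVec at hm'
    rw [hm1] at hm'
    have h0 : 0 ≤ (s3 - s1) * m 0 ^ 2 := mul_nonneg (by linarith) (sq_nonneg _)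
    have : k = s1 + (s3 - s1) * m 0 ^ 2 := by
      rw [hk]; linear_combination s1 * hm'
    linarith
  have hkeq : k = 3 * s2 * (1 - 2 * ub) := by
    have h := congrArg Matrix.det heq
    rw [det_conj_so3 _ _ hR, det_comb _ _ _ _ _ hm hm1, ← hk, Matrix.det_diagonal] at h
    simp [Fin.prod_univ_three] at h
    have hmain : ub * (s1 * s3) + k * (s2 - ub) = s2 ^ 2 * (1 - 2 * ub) := by
      field_simp at h
      have hu2 : ub ^ 2 ≠ 0 := by positivity
      apply mul_left_cancel₀ hu2
      linear_combination -ub ^ 2 * h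
    unfold bpoly at hub
    apply mul_left_cancel₀ (sub_ne_zero.mpr hus.ne)
    linear_combination hmain - hub
  have hu2 : ub < 1 / 2 := by
    rw [hkeq] at hkpos
    have := (pos_iff_pos_of_mul_pos hkpos).mp (by positivity)
    linarith
  have key : ∀ t ∈ Set.Icc (0 : ℝ) 1, s2 ≤ F2 t ∧ F2 t ≤ ub ∧ (t < 1 → F2 t < ub) ∧
      F1 t + F3 t = 1 - F2 t ∧
      ub * (F1 t * F3 t) = F2 t * (1 - 2 * ub) * (3 * ub - 2 * F2 t) := by
    intro t ht
    have hden : 0 < ub + t * (s2 - ub) := by nlinarith [ht.1, ht.2]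
    have hF : F2 t = s2 * ub / (ub + t * (s2 - ub)) := by
      rw [hF2 t ht]
      unfold etaFun
      have : ub / s2 + t * (1 - ub / s2) = (ub + t * (s2 - ub)) / s2 := by
        field_simp
      rw [this]
      field_simp
    have hlow : s2 ≤ F2 t := by
      rw [hF, le_div_iff₀ hden]
      nlinarith [ht.1, mul_nonneg ht.1 (sub_pos.mpr hus).le]
    have hx0 : 0 < F2 t := by linarith
    obtain ⟨Q, hQ, hM⟩ := heig t ht
    have htr := congrArg Matrix.trace hM
    have hdet := congrArg Matrix.det hM
    unfold Mcurve at htr hdet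
    rw [trace_conj_so3 _ _ hQ, trace_comb _ _ _ _ _ hm hsum] at htr
    rw [det_conj_so3 _ _ hQ, det_comb _ _ _ _ _ hm hm1, ← hk, ← hF2 t ht,
      Matrix.det_diagonal] at hdet
    simp [Matrix.trace_fin_three, Matrix.diagonal] at htr
    simp [Fin.prod_univ_three] at hdet
    refine ⟨hlow, ?_, ?_, by linarith, ?_⟩
    · rw [hF, div_le_iff₀ hden]
      nlinarith [mul_nonneg (sub_nonneg.mpr ht.2) (sub_pos.mpr hus).le]
    · intro h1
      rw [hF, div_lt_iff₀ hden]
      nlinarith [mul_pos hu (mul_pos (sub_pos.mpr h1) (sub_pos.mpr hus))]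
    · have hx := hF2 t ht
      set e := etaFun (ub / s2) t
      have hprod : F1 t * F3 t = e ^ 2 * (s1 * s3) + e * (1 - e) * k := by
        apply mul_left_cancel₀ hx0.ne'
        linear_combination -hdet
      have hbb : ub * (s1 * s3) = s2 * (3 * ub + 4 * s2 * ub - 2 * s2 - 6 * ub ^ 2) := by
        unfold bpoly at hub
        linear_combination hub
      rw [hprod, hx, hkeq]
      linear_combination e ^ 2 * hbb
  have hpI : p ∈ Set.Icc (0 : ℝ) 1 := ⟨hp, hpq.trans hq⟩
  have hqI : q ∈ Set.Icc (0 : ℝ) 1 := ⟨hp.trans hpq, hq⟩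
  have hplt : p < 1 := lt_of_le_of_ne hpI.2 hp1
  obtain ⟨p1, p2, p3, p4, p5⟩ := key p hpI
  obtain ⟨q1, q2, q3, q4, q5⟩ := key q hqI
  have p3 := p3 hplt
  have hxy : F2 p ≤ F2 q := by
    rw [hF2 p hpI, hF2 q hqI]
    unfold etaFun
    have hb1 : 1 < ub / s2 := by rw [lt_div_iff₀ hs2]; linarith
    apply mul_le_mul_of_nonneg_left _ hs2.le
    apply div_le_div_of_nonneg_left (by positivity)
    · nlinarith [hqI.1, hqI.2]
    · nlinarith
  obtain ⟨op1, op2⟩ := hord p hpI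
  obtain ⟨oq1, oq2⟩ := hord q hqI
  have hx : 0 < F2 p := by linarith
  have hy : 0 < F2 q := by linarith
  have strict : ∀ x a b : ℝ, 0 < x → x < ub → a ≤ x → x ≤ b → a + b = 1 - x →
      ub * (a * b) = x * (1 - 2 * ub) * (3 * ub - 2 * x) → 0 < a ∧ a < x ∧ x < b := by
    intro x a b hx hxu hax hxb hs hpr
    have hP : ub * ((x - a) * (b - x)) = 2 * x * (3 * ub - 1) * (ub - x) := by
      have : b = 1 - x - a := by linarith
      subst this
      linear_combination -hpr
    have h1 : 0 < 2 * x * (3 * ub - 1) * (ub - x) :=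
      mul_pos (mul_pos (by linarith) (by linarith)) (by linarith)
    have h2 : 0 < ub * (a * b) := by
      rw [hpr]; exact mul_pos (mul_pos hx (by linarith)) (by linarith)
    have h3 : 0 < a * b := (mul_pos_iff_of_pos_left hu).mp h2
    refine ⟨(pos_iff_pos_of_mul_pos h3).mpr (by linarith), lt_of_le_of_ne hax ?_,
      lt_of_le_of_ne hxb ?_⟩
    · intro hh; rw [← hP, hh] at h1; simp at h1
    · intro hh; rw [← hP, hh] at h1; simp at h1
  obtain ⟨sp0, sp1, sp2⟩ := strict _ _ _ hx p3 op1 op2 p4 p5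
  obtain ⟨m1, m3⟩ := core_mono ub (F2 p) (F2 q) (F1 p) (F3 p) (F1 q) (F3 q) hub1 hu2 hx hxy
    (op1.trans op2) p4 p5 (oq1.trans oq2) q4 q5
  have hbm : betaMinus (F1 p) (F2 p) (F3 p) (F1 q) (F2 q) (F3 q) = F2 q / F2 p := by
    unfold betaMinus
    have r1 : F1 q / F1 p ≤ F2 q / F2 p := by
      rw [div_le_div_iff₀ sp0 hx]; linarith
    have r3 : F3 q / F3 p ≤ F2 q / F2 p := by
      rw [div_le_div_iff₀ (by linarith) hx]; linarith
    rw [max_eq_left r3, max_eq_right r1]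
  intro lam hlam
  refine ⟨by linarith, ?_, hbm, ?_⟩
  · have hne : lam ≠ 1 := fun h => hlam.2 h
    have hl : lam * (2 - lam) < 1 := by
      have : 0 < (lam - 1) ^ 2 := by
        have := sub_ne_zero.mpr hne
        positivity
      linarith [this, (by ring : (lam - 1) ^ 2 = 1 - lam * (2 - lam))]
    have hr0 : 0 ≤ (F2 p / F2 q) * ((2 * ub - F2 p) / (2 * ub - F2 q)) :=
      mul_nonneg (div_nonneg hx.le hy.le) (div_nonneg (by linarith) (by linarith))
    have hr1 : (F2 p / F2 q) * ((2 * ub - F2 p) / (2 * ub - F2 q)) ≤ 1 := by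
      rw [div_mul_div_comm, div_le_one (mul_pos hy (by linarith))]
      have hm0 : 0 ≤ (F2 q - F2 p) * (2 * ub - F2 p - F2 q) :=
        mul_nonneg (by linarith) (by linarith)
      have hm2 : F2 q * (2 * ub - F2 q) - F2 p * (2 * ub - F2 p) =
        (F2 q - F2 p) * (2 * ub - F2 p - F2 q) := by ring
      linarith
    set r := (F2 p / F2 q) * ((2 * ub - F2 p) / (2 * ub - F2 q))
    rcases le_or_gt (lam * (2 - lam)) 0 with h | h
    · have := mul_nonpos_of_nonpos_of_nonneg h hr0
      linarith
    · have := mul_le_of_le_one_right h.le hr1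
      linarith
  · intro hq1
    obtain ⟨sq0, sq1, sq2⟩ := strict _ _ _ hy (q3 hq1) oq1 oq2 q4 q5
    rw [hbm]
    unfold betaPlus
    exact lt_min (div_lt_div_of_pos_left hy sp0 sp1) (div_lt_div_of_pos_right sq2 hx)
end
end

section
/- Let 0 ≤ p ≤ q ≤ 1 with p ≠ 1 and set Λ_β(p,q) := F₂(q)/F₂(p). Then M_β(q) = Λ_β(p,q) M_β(p) + (1 − Λ_β(p,q)) m⊗m, and for every λ ∈ A(M_β(p), M_β(q)) one has h_β(λ, p, q) ≥ h_β(Λ_β(p,q), p, q); that is, the minimum of h_β(·, p, q) over A(M_β(p), M_β(q)) is attained at λ = Λ_β(p,q) = β₋(M_β(p), M_β(q)). (Proposition 8.1.) -/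
open Matrix Set

noncomputable section

/-- The pinned inequality for positive `lam` with `y * lam ≤ 3u - 2z`. -/
theorem s17_core (u y z lam r s : ℝ) (hy : 0 < y) (hyz : y ≤ z) (hzu : z ≤ u)
    (hyu : y < u) (hl : 0 < lam) (hl1 : lam ≠ 1) (hlu : y * lam ≤ 3 * u - 2 * z)
    (hr : r = (y / z) * ((2 * u - y) / (2 * u - z)))
    (hs : s = (y ^ 2 / z ^ 2) * ((3 * u - 2 * y) / (3 * u - 2 * z))) :
    (1 - (z / y) ^ 2 * (3 - 2 * (z / y)) * s) / ((z / y) * (1 - (z / y) * (2 - z / y) * r)) ≤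
    (1 - lam ^ 2 * (3 - 2 * lam) * s) / (lam * (1 - lam * (2 - lam) * r)) := by
  have hz : 0 < z := by linarith
  have hu : 0 < u := by linarith
  have h2 : 0 < 2 * u - z := by linarith
  have h3 : 0 < 3 * u - 2 * z := by linarith
  rcases hyz.eq_or_lt with h | h
  · subst h
    have hr1 : r = 1 := by rw [hr]; field_simp
    have hs1 : s = 1 := by
      rw [hs, div_self h3.ne', div_self (pow_pos hy 2).ne', mul_one]
    rw [hr1, hs1, div_self hy.ne']
    norm_num
    apply div_nonneg
    · nlinarith [mul_nonneg (sq_nonneg (1 - lam)) (by linarith : (0:ℝ) ≤ 1 + 2 * lam)]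
    · apply mul_nonneg hl.le
      nlinarith [sq_nonneg (1 - lam)]
  · have hzy : 0 < z - y := by linarith
    have huy : 0 < u - y := by linarith
    have hr1 : r < 1 := by
      rw [hr, div_mul_div_comm, div_lt_one (by positivity)]
      nlinarith [mul_pos hzy (by linarith : 0 < 2 * u - z - y)]
    have hr0 : 0 < r := by
      rw [hr]
      have : 0 < 2 * u - y := by linarith
      positivity
    have hD : 0 < 1 - lam * (2 - lam) * r := by
      nlinarith [mul_nonneg (sq_nonneg (1 - lam)) hr0.le]
    have hH : (1 - (z / y) ^ 2 * (3 - 2 * (z / y)) * s) /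
        ((z / y) * (1 - (z / y) * (2 - z / y) * r))
        = 3 * (2 * u - z) * y / ((3 * u - 2 * z) * z) := by
      have e1 : 1 - (z / y) ^ 2 * (3 - 2 * (z / y)) * s
          = 6 * (z - y) * (u - y) / (y * (3 * u - 2 * z)) := by
        rw [hs]
        obtain ⟨d, hd⟩ : ∃ d, d = 3 * u - 2 * z := ⟨_, rfl⟩
        rw [← hd] at h3 ⊢
        field_simp
        rw [hd]
        ring
      have e2 : 1 - (z / y) * (2 - z / y) * r
          = 2 * (z - y) * (u - y) / (y * (2 * u - z)) := by
        rw [hr]; field_simp; ring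
      rw [e1, e2]
      field_simp
      ring
    rw [hH, le_div_iff₀ (by positivity), ← sub_nonneg]
    have e : 1 - lam ^ 2 * (3 - 2 * lam) * s -
        3 * (2 * u - z) * y / ((3 * u - 2 * z) * z) * (lam * (1 - lam * (2 - lam) * r))
        = (y * lam - z) ^ 2 * (3 * u - 2 * z - y * lam) / (z ^ 2 * (3 * u - 2 * z)) := by
      rw [hs, hr]; field_simp; ring
    rw [e]
    have : 0 ≤ 3 * u - 2 * z - y * lam := by linarith
    positivity

/-- Both roots straddle `w = 3 z (1 - 2u)`. -/
theorem s17_mid (u z g1 g3 : ℝ) (hu : 1 / 3 < u) (hu2 : u < 1 / 2)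
    (hg : g1 ≤ g3) (hsum : g1 + g3 = 1 - z)
    (hprod : u * (g1 * g3) = z * (3 * u - 2 * z) * (1 - 2 * u)) :
    g1 ≤ 3 * z * (1 - 2 * u) ∧ 3 * z * (1 - 2 * u) ≤ g3 := by
  have e : u * ((3 * z * (1 - 2 * u) - g1) * (3 * z * (1 - 2 * u) - g3))
      = -2 * z ^ 2 * (1 - 2 * u) * (3 * u - 1) ^ 2 := by
    linear_combination hprod - u * (3 * z * (1 - 2 * u)) * hsum
  have h0 : 0 < 1 - 2 * u := by linarith
  have hn : (3 * z * (1 - 2 * u) - g1) * (3 * z * (1 - 2 * u) - g3) ≤ 0 := by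
    have : 0 ≤ z ^ 2 * (1 - 2 * u) * (3 * u - 1) ^ 2 := by positivity
    by_contra hc
    push Not at hc
    have := mul_pos (by linarith : 0 < u) hc
    linarith
  constructor
  · by_contra hc
    push Not at hc
    nlinarith
  · by_contra hc
    push Not at hc
    nlinarith

theorem s17_ratio (u y z f1 f3 g1 g3 : ℝ) (hu : 1 / 3 < u) (hu2 : u < 1 / 2)
    (hy : 0 < y) (hyz : y ≤ z)
    (hf : f1 ≤ f3) (hfs : f1 + f3 = 1 - y)
    (hfp : u * (f1 * f3) = y * (3 * u - 2 * y) * (1 - 2 * u))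
    (hg : g1 ≤ g3) (hgs : g1 + g3 = 1 - z)
    (hgp : u * (g1 * g3) = z * (3 * u - 2 * z) * (1 - 2 * u)) :
    g1 * y ≤ z * f1 ∧ g3 * y ≤ z * f3 := by
  have hz : 0 < z := by linarith
  obtain ⟨a1, a2⟩ := s17_mid u y f1 f3 hu hu2 hf hfs hfp
  obtain ⟨b1, b2⟩ := s17_mid u z g1 g3 hu hu2 hg hgs hgp
  have hu0 : 0 < u := by linarith
  -- the characteristic identity
  have key : ∀ X : ℝ, (y * X - z * f1) * (y * X - z * f3) - y ^ 2 * ((X - g1) * (X - g3))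
      = y * (z - y) * (3 * z * (1 - 2 * u) - X) := by
    intro X
    apply mul_left_cancel₀ hu0.ne'
    linear_combination z ^ 2 * hfp - y ^ 2 * hgp - u * y * X * z * hfs + u * y ^ 2 * X * hgs
  constructor
  · by_contra hc
    push Not at hc
    have hX : y * (z * f1 / y) = z * f1 := by field_simp
    have k := key (z * f1 / y)
    rw [hX] at k
    have c1 : z * f1 / y < g1 := by rw [div_lt_iff₀ hy]; exact hc
    have p1 : 0 < (z * f1 / y - g1) * (z * f1 / y - g3) :=
      mul_pos_of_neg_of_neg (by linarith) (by linarith)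
    have p2 : 0 ≤ y * (z - y) * (3 * z * (1 - 2 * u) - z * f1 / y) :=
      mul_nonneg (mul_nonneg hy.le (by linarith)) (by linarith)
    have := mul_pos (pow_pos hy 2) p1
    linarith
  · by_contra hc
    push Not at hc
    have k := key g3
    have p2 : 0 ≤ y * (z - y) * (g3 - 3 * z * (1 - 2 * u)) :=
      mul_nonneg (mul_nonneg hy.le (by linarith)) (by linarith)
    have p1 : 0 < (y * g3 - z * f1) * (y * g3 - z * f3) :=
      mul_pos (by nlinarith) (by linarith)
    linarith

theorem s17_top (u z g1 g3 : ℝ) (hu : 1 / 3 < u) (hz : 0 < z) (hzu : z ≤ u)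
    (hgs : g1 + g3 = 1 - z)
    (hgp : u * (g1 * g3) = z * (3 * u - 2 * z) * (1 - 2 * u)) : g3 ≤ 3 * u - 2 * z := by
  have e : u * ((3 * u - 2 * z - g1) * (3 * u - 2 * z - g3))
      = (3 * u - 2 * z) * (3 * u - 1) * (u - z) := by
    linear_combination hgp - u * (3 * u - 2 * z) * hgs
  have h1 : 0 ≤ (3 * u - 2 * z) * (3 * u - 1) * (u - z) :=
    mul_nonneg (mul_nonneg (by linarith) (by linarith)) (by linarith)
  have hu0 : 0 < u := by linarith
  have h2 : 0 ≤ (3 * u - 2 * z - g1) * (3 * u - 2 * z - g3) := by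
    by_contra hc
    push Not at hc
    nlinarith
  by_contra hc
  push Not at hc
  nlinarith

theorem s17_trace (M Q : Matrix (Fin 3) (Fin 3) ℝ) (hQ : IsSO3 Q) :
    (Qᵀ * M * Q).trace = M.trace := by
  rw [Matrix.trace_mul_cycle, mul_eq_one_comm.mp hQ.1, Matrix.one_mul]

theorem s17_det (M Q : Matrix (Fin 3) (Fin 3) ℝ) (hQ : IsSO3 Q) :
    (Qᵀ * M * Q).det = M.det := by
  rw [Matrix.det_mul, Matrix.det_mul, Matrix.det_transpose, hQ.2]; ring

theorem s17_detM (s1 s2 s3 e : ℝ) (m : Fin 3 → ℝ) (hm1 : m 1 = 0) :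
    (e • Matrix.diagonal ![s1, s2, s3] + (1 - e) • outer m).det
      = e * s2 * (e ^ 2 * s1 * s3 + e * (1 - e) * (s1 * m 2 ^ 2 + s3 * m 0 ^ 2)) := by
  rw [Matrix.det_fin_three]
  simp [outer, Matrix.vecMulVec_apply, hm1]
  ring

theorem s17_traceM (s1 s2 s3 e : ℝ) (m : Fin 3 → ℝ) (hm1 : m 1 = 0) (hm : unitVec m)
    (hsum : s1 + s2 + s3 = 1) :
    (e • Matrix.diagonal ![s1, s2, s3] + (1 - e) • outer m).trace = 1 := by
  unfold unitVec at hm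
  rw [Matrix.trace_fin_three]
  simp [outer, Matrix.vecMulVec_apply, hm1]
  rw [hm1] at hm
  linear_combination e * hsum + (1 - e) * hm

theorem s17_detD (a b c : ℝ) : (Matrix.diagonal ![a, b, c]).det = a * b * c := by
  rw [Matrix.det_diagonal, Fin.prod_univ_three]; rfl

theorem s17_traceD (a b c : ℝ) : (Matrix.diagonal ![a, b, c]).trace = a + b + c := by
  rw [Matrix.trace_fin_three]; simp

theorem statement17 (s1 s2 s3 ub : ℝ)
    (hs1 : 0 < s1) (hs12 : s1 < s2) (hs23 : s2 < s3) (hsum : s1 + s2 + s3 = 1)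
    (hub : bpoly s1 s2 s3 ub = 0) (hubmax : ∀ x : ℝ, bpoly s1 s2 s3 x = 0 → x ≤ ub)
    (hub1 : 1 / 3 < ub) (hub2 : ub ≤ s3)
    (S : Matrix (Fin 3) (Fin 3) ℝ) (hS : S = Matrix.diagonal ![s1, s2, s3])
    (m : Fin 3 → ℝ) (hm : unitVec m) (hm1 : m 1 = 0)
    (R : Matrix (Fin 3) (Fin 3) ℝ) (hR : IsSO3 R)
    (heq : Rᵀ * Matrix.diagonal ![1 - 2 * ub, ub, ub] * R =
      (ub / s2) • S + (1 - ub / s2) • outer m)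
    (F1 F2 F3 : ℝ → ℝ)
    (hord : ∀ t ∈ Set.Icc (0 : ℝ) 1, F1 t ≤ F2 t ∧ F2 t ≤ F3 t)
    (heig : ∀ t ∈ Set.Icc (0 : ℝ) 1, ∃ Q : Matrix (Fin 3) (Fin 3) ℝ, IsSO3 Q ∧
      Qᵀ * Mcurve S m (ub / s2) t * Q = Matrix.diagonal ![F1 t, F2 t, F3 t])
    (hF2 : ∀ t ∈ Set.Icc (0 : ℝ) 1, F2 t = s2 * etaFun (ub / s2) t)
    (p q : ℝ) (hp : 0 ≤ p) (hpq : p ≤ q) (hq : q ≤ 1) (hp1 : p ≠ 1)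
    (rpq spq : ℝ)
    (hrpq : rpq = (F2 p / F2 q) * ((2 * ub - F2 p) / (2 * ub - F2 q)))
    (hspq : spq = (F2 p ^ 2 / F2 q ^ 2) * ((3 * ub - 2 * F2 p) / (3 * ub - 2 * F2 q)))
    (hb : ℝ → ℝ)
    (hhb : ∀ lam : ℝ, hb lam =
      (1 - lam ^ 2 * (3 - 2 * lam) * spq) / (lam * (1 - lam * (2 - lam) * rpq))) :
    Mcurve S m (ub / s2) q =
      (F2 q / F2 p) • Mcurve S m (ub / s2) p + (1 - F2 q / F2 p) • outer m ∧
    F2 q / F2 p = betaMinus (F1 p) (F2 p) (F3 p) (F1 q) (F2 q) (F3 q) ∧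
    (∀ lam ∈ setA (F1 p) (F2 p) (F3 p) (F1 q) (F2 q) (F3 q),
      hb (F2 q / F2 p) ≤ hb lam) := by
  have hs2 : 0 < s2 := by linarith
  have hu0 : 0 < ub := by linarith
  have hb' : ub * (s1 * s3) = s2 * (3 * ub - 2 * s2) * (1 - 2 * ub) := by
    unfold bpoly at hub
    linear_combination hub
  have hs2u : s2 < ub := by
    by_contra hc
    push Not at hc
    have e3 : ub * ((s2 - s1) * (s3 - s2)) = -(2 * s2 * ((s2 - ub) * (3 * ub - 1))) := by
      unfold bpoly at hub
      linear_combination (-1) * hub + ub * s2 * hsum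
    have e4 : 0 < ub * ((s2 - s1) * (s3 - s2)) :=
      mul_pos hu0 (mul_pos (by linarith) (by linarith))
    have e5 : 0 ≤ 2 * s2 * ((s2 - ub) * (3 * ub - 1)) :=
      mul_nonneg (by linarith) (mul_nonneg (by linarith) (by linarith))
    linarith
  have hu2 : ub < 1 / 2 := by
    by_contra hc
    push Not at hc
    have h1 : 0 < ub * (s1 * s3) := mul_pos hu0 (mul_pos hs1 (by linarith))
    have h2 : 0 ≤ s2 * (3 * ub - 2 * s2) * (2 * ub - 1) :=
      mul_nonneg (mul_nonneg hs2.le (by linarith)) (by linarith)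
    linarith
  have hsig : s1 * m 2 ^ 2 + s3 * m 0 ^ 2 = 3 * s2 * (1 - 2 * ub) := by
    have h := congrArg Matrix.det heq
    rw [s17_det _ _ hR, hS, s17_detM _ _ _ _ _ hm1, s17_detD] at h
    generalize s1 * m 2 ^ 2 + s3 * m 0 ^ 2 = σ at h ⊢
    have h' : s2 ^ 2 * (1 - 2 * ub) = ub * (s1 * s3) + (s2 - ub) * σ := by
      field_simp at h
      first
        | linear_combination h
        | (apply mul_left_cancel₀ hu0.ne'; linear_combination h)
    have hne : ub - s2 ≠ 0 := by linarith
    apply mul_left_cancel₀ hne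
    linear_combination hb' + h'
  have heta : ∀ t ∈ Set.Icc (0 : ℝ) 1, 0 < ub / s2 + t * (1 - ub / s2) := by
    intro t ht
    have hβ : 1 < ub / s2 := by rw [lt_div_iff₀ hs2]; linarith
    nlinarith [mul_nonneg (sub_nonneg.mpr ht.2) (sub_nonneg.mpr hβ.le)]
  have hβ : 1 < ub / s2 := by rw [lt_div_iff₀ hs2]; linarith
  have hfact : ∀ t ∈ Set.Icc (0 : ℝ) 1, F1 t + F3 t = 1 - F2 t ∧
      ub * (F1 t * F3 t) = F2 t * (3 * ub - 2 * F2 t) * (1 - 2 * ub) ∧ 0 < F2 t := by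
    intro t ht
    have hD := heta t ht
    have he : 0 < etaFun (ub / s2) t := by
      unfold etaFun
      positivity
    have hpos : 0 < F2 t := by rw [hF2 t ht]; positivity
    obtain ⟨Q, hQ, hQe⟩ := heig t ht
    have htr := congrArg Matrix.trace hQe
    have hdet := congrArg Matrix.det hQe
    unfold Mcurve at htr hdet
    rw [s17_trace _ _ hQ, hS, s17_traceM _ _ _ _ _ hm1 hm hsum, s17_traceD] at htr
    rw [s17_det _ _ hQ, hS, s17_detM _ _ _ _ _ hm1, s17_detD, hsig] at hdet
    refine ⟨by linarith, ?_, hpos⟩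
    apply mul_left_cancel₀ hpos.ne'
    rw [hF2 t ht] at hdet ⊢
    generalize etaFun (ub / s2) t = e at *
    linear_combination (-ub) * hdet + e ^ 3 * s2 * hb'
  have hpI : p ∈ Set.Icc (0 : ℝ) 1 := ⟨hp, hpq.trans hq⟩
  have hqI : q ∈ Set.Icc (0 : ℝ) 1 := ⟨hp.trans hpq, hq⟩
  have hpD := heta p hpI
  have hqD := heta q hqI
  have hp1' : p < 1 := lt_of_le_of_ne (hpq.trans hq) hp1
  obtain ⟨hfs, hfp, hy⟩ := hfact p hpI
  obtain ⟨hgs, hgp, hz⟩ := hfact q hqI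
  obtain ⟨hf12, hf23⟩ := hord p hpI
  obtain ⟨hg12, hg23⟩ := hord q hqI
  have hyz : F2 p ≤ F2 q := by
    rw [hF2 p hpI, hF2 q hqI]
    apply mul_le_mul_of_nonneg_left _ hs2.le
    unfold etaFun
    apply div_le_div_of_nonneg_left (by linarith) hqD
    linarith [mul_nonneg (sub_nonneg.mpr hpq) (sub_nonneg.mpr hβ.le)]
  have hub' : ub = s2 * (ub / s2) := by field_simp
  have hzu : F2 q ≤ ub := by
    rw [hF2 q hqI]
    conv_rhs => rw [hub']
    apply mul_le_mul_of_nonneg_left _ hs2.le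
    unfold etaFun
    apply div_le_self (by linarith)
    linarith [mul_nonneg (sub_nonneg.mpr hq) (sub_nonneg.mpr hβ.le)]
  have hyu : F2 p < ub := by
    rw [hF2 p hpI]
    conv_rhs => rw [hub']
    apply mul_lt_mul_of_pos_left _ hs2
    unfold etaFun
    apply div_lt_self (by linarith)
    linarith [mul_pos (sub_pos.mpr hp1') (sub_pos.mpr hβ)]
  have hpos1 : ∀ a b y : ℝ, 0 < y → y ≤ ub → a + b = 1 - y →
      ub * (a * b) = y * (3 * ub - 2 * y) * (1 - 2 * ub) → 0 < a ∧ 0 < b := by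
    intro a b y hy hyu hab hpr
    have h1 : 0 < y * (3 * ub - 2 * y) * (1 - 2 * ub) :=
      mul_pos (mul_pos hy (by linarith)) (by linarith)
    rw [← hpr] at h1
    have h2 : 0 < a * b := (mul_pos_iff_of_pos_left hu0).mp h1
    rcases mul_pos_iff.mp h2 with h | h
    · exact h
    · linarith [h.1, h.2]
  obtain ⟨hf1, hf3⟩ := hpos1 _ _ _ hy hyu.le hfs hfp
  obtain ⟨hg1, hg3⟩ := hpos1 _ _ _ hz hzu hgs hgp
  obtain ⟨hr1, hr3⟩ := s17_ratio ub _ _ _ _ _ _ hub1 hu2 hy hyz (hf12.trans hf23) hfs hfp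
    (hg12.trans hg23) hgs hgp
  have htop := s17_top ub _ _ _ hub1 hz hzu hgs hgp
  refine ⟨?_, ?_, ?_⟩
  · have hep : etaFun (ub / s2) p ≠ 0 := by
      intro h0
      rw [hF2 p hpI, h0] at hy
      simp at hy
    have hL : F2 q / F2 p * etaFun (ub / s2) p = etaFun (ub / s2) q := by
      rw [hF2 p hpI, hF2 q hqI]
      field_simp
    unfold Mcurve
    rw [← hL]
    module
  · unfold betaMinus
    have a1 : F1 q / F1 p ≤ F2 q / F2 p := by rw [div_le_div_iff₀ hf1 hy]; exact hr1
    have a3 : F3 q / F3 p ≤ F2 q / F2 p := by rw [div_le_div_iff₀ hf3 hy]; exact hr3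
    rw [max_eq_left a3, max_eq_right a1]
  · intro lam hlam
    obtain ⟨hmem, hne⟩ := hlam
    rw [hhb, hhb]
    have hne1 : lam ≠ 1 := hne
    have hcond : 0 < lam ∧ F2 p * lam ≤ 3 * ub - 2 * F2 q := by
      rcases hmem with h | h
      · have hl0 : 0 < lam :=
          lt_of_lt_of_le (lt_of_lt_of_le (div_pos hg1 hy) (le_max_left _ _)) h.1
        refine ⟨hl0, ?_⟩
        have h2 := h.2
        unfold alphaPlus at h2
        rw [le_min_iff, le_min_iff, le_div_iff₀ hf1, le_div_iff₀ hy, le_div_iff₀ hf3] at h2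
        obtain ⟨k1, k2, k3⟩ := h2
        have : lam ≤ 1 := by
          have : lam * (F1 p + F3 p + F2 p) ≤ 1 := by linarith
          rwa [hfs, sub_add_cancel, mul_one] at this
        have := mul_le_mul_of_nonneg_left this hy.le
        linarith
      · refine ⟨lt_of_lt_of_le (lt_of_lt_of_le (div_pos hg1 hf1) (le_max_left _ _)) h.1, ?_⟩
        have h2 := h.2.trans (min_le_right _ _)
        rw [le_div_iff₀ hy] at h2
        linarith
    exact s17_core ub _ _ lam rpq spq hy hyz hzu hyu hcond.1 hne1 hcond.2 hrpq hspq
end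
end

section
/- The functions t ↦ i₂(M_α(t)) and t ↦ i₂(M_β(t)) are strictly increasing on [0,1]; moreover, if t, t' ∈ [0,1] satisfy i₂(M_α(t)) = i₂(M_β(t')) and i₃(M_α(t)) = i₃(M_β(t')), then t = t' = 0 (so the curves γ_α and γ_β in the (i₂, i₃)-plane are graphs over the i₂-axis and intersect only at the point (i₂(S), i₃(S))). (Lemma 4.4, first part.) -/
open Matrix Set

noncomputable section

lemma aux_i2 (s1 s2 s3 e : ℝ) (n : Fin 3 → ℝ) (hn : unitVec n) (hn1 : n 1 = 0)
    (hsum : s1 + s2 + s3 = 1) :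
    i2 (e • Matrix.diagonal ![s1, s2, s3] + (1 - e) • outer n) =
      e ^ 2 * (s1 * s3 + s2 * (s1 + s3)) +
        e * (1 - e) * (s2 + (s3 * n 0 ^ 2 + s1 * n 2 ^ 2)) := by
  have h : n 2 ^ 2 = 1 - n 0 ^ 2 := by
    unfold unitVec at hn; rw [hn1] at hn; linarith
  have h3 : s3 = 1 - s1 - s2 := by linarith
  subst h3
  simp [i2, outer, Matrix.trace, Fin.sum_univ_three, Matrix.mul_apply, Matrix.vecMulVec_apply, hn1]
  ring_nf
  simp only [h]
  ring

lemma aux_i3 (s1 s2 s3 e : ℝ) (n : Fin 3 → ℝ) (hn1 : n 1 = 0) :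
    i3 (e • Matrix.diagonal ![s1, s2, s3] + (1 - e) • outer n) =
      e ^ 3 * (s1 * s2 * s3) + e ^ 2 * (1 - e) * s2 * (s3 * n 0 ^ 2 + s1 * n 2 ^ 2) := by
  simp [i3, outer, Matrix.det_fin_three, Matrix.vecMulVec_apply, hn1]
  ring

lemma aux_q (s1 s2 s3 : ℝ) (n : Fin 3 → ℝ) (hn : unitVec n) (hn1 : n 1 = 0)
    (hs13 : s1 < s3) : s1 ≤ s3 * n 0 ^ 2 + s1 * n 2 ^ 2 := by
  unfold unitVec at hn; rw [hn1] at hn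
  have h : n 2 ^ 2 = 1 - n 0 ^ 2 := by linarith
  rw [h]
  nlinarith [mul_nonneg (sub_pos.2 hs13).le (sq_nonneg (n 0))]

lemma aux_K (s1 s2 s3 u d : ℝ) (D R : Matrix (Fin 3) (Fin 3) ℝ) (n : Fin 3 → ℝ) (hn1 : n 1 = 0)
    (hR : IsSO3 R) (hs : 0 < s2) (hu : 0 < u) (hD : D.det = u ^ 2 * (1 - 2 * u))
    (h : Rᵀ * D * R =
      (u / s2) • Matrix.diagonal ![s1, s2, s3] + (1 - u / s2) • outer n) :
    u * (s1 * s3) + (s2 - u) * (s3 * n 0 ^ 2 + s1 * n 2 ^ 2) = s2 ^ 2 * (1 - 2 * u) := by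
  have h1 := congrArg i3 h
  rw [aux_i3 _ _ _ _ _ hn1] at h1
  simp only [i3, Matrix.det_mul, Matrix.det_transpose, hR.2, hD] at h1
  field_simp at h1
  linarith

/-- Key algebraic facts. -/
lemma aux_alg (s1 s2 s3 u q : ℝ)
    (hs1 : 0 < s1) (hs12 : s1 < s2) (hs23 : s2 < s3) (hsum : s1 + s2 + s3 = 1)
    (hb : bpoly s1 s2 s3 u = 0) (hu : u ≠ s2)
    (K : u * (s1 * s3) + (s2 - u) * q = s2 ^ 2 * (1 - 2 * u)) :
    2 * (q + s2 ^ 2 - s1 * s3) * (u / s2) = s2 + q ∧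
    (q + s2 ^ 2 - s1 * s3) * (u / s2) = 2 * s2 - 3 * s2 * u := by
  have hs : s2 ≠ 0 := by linarith
  have hd : s2 - u ≠ 0 := fun h => hu (by linarith)
  unfold bpoly at hb
  have h1 : 2 * (q + s2 ^ 2 - s1 * s3) * u = s2 * (s2 + q) := by
    apply mul_left_cancel₀ hd
    linear_combination (2 * u - s2) * K - s2 * hb
  have h2 : (q + s2 ^ 2 - s1 * s3) * u = s2 * (2 * s2 - 3 * s2 * u) := by
    linear_combination h1 + K
  constructor
  · field_simp; linarith
  · field_simp; linarith

lemma aux_eta_zero (l : ℝ) (hl : 0 < l) (hl1 : l ≠ 1) (t : ℝ) (ht : t ∈ Set.Icc (0 : ℝ) 1)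
    (h : etaFun l t = 1) : t = 0 := by
  have hD : 0 < l + t * (1 - l) := by
    rcases lt_or_gt_of_ne hl1 with h | h <;> nlinarith [ht.1, ht.2]
  unfold etaFun at h
  rw [div_eq_one_iff_eq hD.ne'] at h
  have : t * (1 - l) = 0 := by linarith
  rcases mul_eq_zero.1 this with h | h
  · exact h
  · exact absurd (by linarith) hl1

lemma aux_D (l : ℝ) (hl : 0 < l) (t : ℝ) (ht : t ∈ Set.Icc (0 : ℝ) 1) :
    0 < l + t * (1 - l) := by
  rcases lt_or_ge l 1 with h | h <;> nlinarith [ht.1, ht.2]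

lemma aux_mono (l A : ℝ) (hl : 0 < l) (hl1 : l ≠ 1) (hA : 0 < A) :
    StrictMonoOn (fun t => A * (2 * l * etaFun l t - etaFun l t ^ 2)) (Set.Icc 0 1) := by
  intro a ha b hb hab
  have hDa := aux_D l hl a ha
  have hDb := aux_D l hl b hb
  apply mul_lt_mul_of_pos_left _ hA
  have key : ∀ t ∈ Set.Icc (0:ℝ) 1, 2 * l * etaFun l t - etaFun l t ^ 2
      = l ^ 2 - (l * (1 - l) * (1 - t) / (l + t * (1 - l))) ^ 2 := by
    intro t ht
    have := aux_D l hl t ht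
    unfold etaFun
    field_simp
    ring
  rw [key a ha, key b hb]
  have h1 : 0 < (l * (1 - l)) ^ 2 := by
    have : l * (1 - l) ≠ 0 := mul_ne_zero hl.ne' (fun h => hl1 (by linarith))
    positivity
  have h2 : (1 - b) / (l + b * (1 - l)) < (1 - a) / (l + a * (1 - l)) := by
    rw [div_lt_div_iff₀ hDb hDa]
    nlinarith
  have h3 : 0 ≤ (1 - b) / (l + b * (1 - l)) := div_nonneg (by linarith [hb.2]) hDb.le
  have h4 : ((1 - b) / (l + b * (1 - l))) ^ 2 < ((1 - a) / (l + a * (1 - l))) ^ 2 :=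
    pow_lt_pow_left₀ h2 h3 (by norm_num)
  have := mul_lt_mul_of_pos_left h4 h1
  simp only [← mul_pow, ← mul_div_assoc] at this
  linarith

/-- `s₂ η` is a middle eigenvalue along the curve. -/
lemma aux_mid (s1 s2 s3 u A e : ℝ)
    (hs1 : 0 < s1) (hs12 : s1 < s2) (hs23 : s2 < s3) (hsum : s1 + s2 + s3 = 1)
    (hl1 : u / s2 ≠ 1) (he : 0 < e) (hbet : 0 ≤ (e - u / s2) * (1 - u / s2))
    (h1 : 2 * A * (u / s2) = A + s1 * s3 + s2 * (s1 + s3))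
    (h2 : A * (u / s2) = 2 * s2 - 3 * s2 * u) :
    3 * (s2 * e) ^ 2 - 2 * (s2 * e) + A * (2 * (u / s2) * e - e ^ 2) ≤ 0 := by
  have hs : s2 ≠ 0 := by linarith
  obtain ⟨l, hl⟩ : ∃ l, l = u / s2 := ⟨_, rfl⟩
  have hu : u = s2 * l := by rw [hl]; field_simp
  rw [← hl] at hl1 hbet h1 h2 ⊢
  clear hl
  subst hu
  have hf : 3 * (s2 * e) ^ 2 - 2 * (s2 * e) + A * (2 * l * e - e ^ 2)
      = e * (3 * s2 ^ 2 - A) * (e - l) := by linear_combination e * h2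
  have hneg : (3 * s2 ^ 2 - A) * (1 - l) < 0 := by
    have : (3 * s2 ^ 2 - A) * (1 - l) = (s2 - s1) * (s2 - s3) := by
      have h3 : s3 = 1 - s1 - s2 := by linarith
      subst h3
      linear_combination h1 - h2
    rw [this]; nlinarith
  have hsq : 0 < (1 - l) ^ 2 := by
    have : 1 - l ≠ 0 := fun h => hl1 (by linarith)
    positivity
  rw [hf]
  by_contra hc
  push Not at hc
  have p1 := mul_pos hc hsq
  have p2 := mul_nonneg (mul_nonneg he.le hbet) (neg_pos.2 hneg).le
  nlinarith

lemma aux_curve (s1 s2 s3 u d : ℝ) (n : Fin 3 → ℝ) (D R : Matrix (Fin 3) (Fin 3) ℝ)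
    (hs1 : 0 < s1) (hs12 : s1 < s2) (hs23 : s2 < s3) (hsum : s1 + s2 + s3 = 1)
    (hb : bpoly s1 s2 s3 u = 0) (hu : u ≠ s2) (hu0 : 0 < u)
    (hn : unitVec n) (hn1 : n 1 = 0) (hR : IsSO3 R) (hD : D.det = u ^ 2 * (1 - 2 * u))
    (h : Rᵀ * D * R =
      (u / s2) • Matrix.diagonal ![s1, s2, s3] + (1 - u / s2) • outer n) :
    StrictMonoOn (fun t => i2 (Mcurve (Matrix.diagonal ![s1, s2, s3]) n (u / s2) t))
      (Set.Icc 0 1) ∧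
    ∀ t ∈ Set.Icc (0 : ℝ) 1,
      (0 ≤ (1 - etaFun (u / s2) t) * (1 - u / s2)) ∧
      3 * (s2 * etaFun (u / s2) t) ^ 2 - 2 * (s2 * etaFun (u / s2) t)
        + i2 (Mcurve (Matrix.diagonal ![s1, s2, s3]) n (u / s2) t) ≤ 0 ∧
      (s2 * etaFun (u / s2) t) ^ 3 - (s2 * etaFun (u / s2) t) ^ 2
        + (s2 * etaFun (u / s2) t) * i2 (Mcurve (Matrix.diagonal ![s1, s2, s3]) n (u / s2) t)
        = i3 (Mcurve (Matrix.diagonal ![s1, s2, s3]) n (u / s2) t) := by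
  have hs2 : 0 < s2 := by linarith
  have K := aux_K s1 s2 s3 u d D R n hn1 hR hs2 hu0 hD h
  have hq := aux_q s1 s2 s3 n hn hn1 (by linarith)
  obtain ⟨h1, h2⟩ := aux_alg s1 s2 s3 u _ hs1 hs12 hs23 hsum hb hu K
  have hl : 0 < u / s2 := by positivity
  have hl1 : u / s2 ≠ 1 := by
    intro h; rw [div_eq_one_iff_eq hs2.ne'] at h; exact hu h
  set l := u / s2 with hldef
  have hi2 : ∀ e, i2 (e • Matrix.diagonal ![s1, s2, s3] + (1 - e) • outer n) =
      (s3 * n 0 ^ 2 + s1 * n 2 ^ 2 + s2 ^ 2 - s1 * s3) * (2 * l * e - e ^ 2) := by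
    intro e
    rw [aux_i2 s1 s2 s3 e n hn hn1 hsum]
    have h3 : s3 = 1 - s1 - s2 := by linarith
    subst h3
    linear_combination (-e) * h1
  have hA : 0 < s3 * n 0 ^ 2 + s1 * n 2 ^ 2 + s2 ^ 2 - s1 * s3 := by nlinarith
  constructor
  · unfold Mcurve
    simp only [hi2]
    exact aux_mono l _ hl hl1 hA
  · intro t ht
    have hDt := aux_D l hl t ht
    have he : 0 < etaFun l t := div_pos hl hDt
    refine ⟨?_, ?_, ?_⟩
    · have : (1 - etaFun l t) * (1 - l) = t * (1 - l) ^ 2 / (l + t * (1 - l)) := by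
        unfold etaFun; field_simp; ring
      rw [this]
      have := ht.1
      positivity
    · unfold Mcurve
      rw [hi2]
      apply aux_mid s1 s2 s3 u _ _ hs1 hs12 hs23 hsum hl1 he
      · have : (etaFun l t - l) * (1 - l) = l * (1 - t) * (1 - l) ^ 2 / (l + t * (1 - l)) := by
          unfold etaFun; field_simp; ring
        rw [← hldef, this]
        have : 0 ≤ 1 - t := by linarith [ht.2]
        positivity
      · rw [← hldef, h1]
        have h3 : s3 = 1 - s1 - s2 := by linarith
        subst h3
        ring
      · exact h2
    · unfold Mcurve
      rw [aux_i2 s1 s2 s3 _ n hn hn1 hsum, aux_i3 _ _ _ _ _ hn1]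
      have h3 : s3 = 1 - s1 - s2 := by linarith
      subst h3
      ring

theorem statement18 (s1 s2 s3 ua ub : ℝ)
    (hs1 : 0 < s1) (hs12 : s1 < s2) (hs23 : s2 < s3) (hsum : s1 + s2 + s3 = 1)
    (hua : bpoly s1 s2 s3 ua = 0) (huamin : ∀ x : ℝ, bpoly s1 s2 s3 x = 0 → ua ≤ x)
    (hub : bpoly s1 s2 s3 ub = 0) (hubmax : ∀ x : ℝ, bpoly s1 s2 s3 x = 0 → x ≤ ub)
    (hua1 : s1 ≤ ua) (hua2 : ua < 1 / 3) (hub1 : 1 / 3 < ub) (hub2 : ub ≤ s3)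
    (S : Matrix (Fin 3) (Fin 3) ℝ) (hS : S = Matrix.diagonal ![s1, s2, s3])
    (n : Fin 3 → ℝ) (hn : unitVec n) (hn1 : n 1 = 0)
    (m : Fin 3 → ℝ) (hm : unitVec m) (hm1 : m 1 = 0)
    (R : Matrix (Fin 3) (Fin 3) ℝ) (hR : IsSO3 R)
    (heqa : Rᵀ * Matrix.diagonal ![ua, ua, 1 - 2 * ua] * R =
      (ua / s2) • S + (1 - ua / s2) • outer n)
    (Rp : Matrix (Fin 3) (Fin 3) ℝ) (hRp : IsSO3 Rp)
    (heqb : Rpᵀ * Matrix.diagonal ![1 - 2 * ub, ub, ub] * Rp =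
      (ub / s2) • S + (1 - ub / s2) • outer m) :
    StrictMonoOn (fun t => i2 (Mcurve S n (ua / s2) t)) (Set.Icc 0 1) ∧
    StrictMonoOn (fun t => i2 (Mcurve S m (ub / s2) t)) (Set.Icc 0 1) ∧
    (∀ t ∈ Set.Icc (0 : ℝ) 1, ∀ t' ∈ Set.Icc (0 : ℝ) 1,
      i2 (Mcurve S n (ua / s2) t) = i2 (Mcurve S m (ub / s2) t') →
      i3 (Mcurve S n (ua / s2) t) = i3 (Mcurve S m (ub / s2) t') →
      t = 0 ∧ t' = 0) := by
  have hbs : bpoly s1 s2 s3 s2 < 0 := by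
    have : bpoly s1 s2 s3 s2 = s2 * ((s2 - s1) * (s2 - s3)) := by
      have h3 : s3 = 1 - s1 - s2 := by linarith
      subst h3
      unfold bpoly
      ring
    rw [this]
    have : (s2 - s1) * (s2 - s3) < 0 := by nlinarith
    have : 0 < s2 := by linarith
    nlinarith
  have hfac : bpoly s1 s2 s3 s2 = 6 * s2 * (s2 - ua) * (s2 - ub) := by
    have hne : ub - ua ≠ 0 := by
      intro h; linarith
    apply mul_left_cancel₀ hne
    unfold bpoly at *
    linear_combination (ub - s2) * hua + (s2 - ua) * hub
  have hs2 : 0 < s2 := by linarith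
  have hlt : (s2 - ua) * (s2 - ub) < 0 := by
    by_contra hc
    push Not at hc
    have := mul_nonneg (by linarith : 0 ≤ 6 * s2) hc
    nlinarith
  have hua3 : ua < s2 := by
    by_contra hc
    push Not at hc
    nlinarith
  have hub3 : s2 < ub := by
    by_contra hc
    push Not at hc
    nlinarith
  subst hS
  obtain ⟨ma, pa⟩ := aux_curve s1 s2 s3 ua 0 n _ R hs1 hs12 hs23 hsum hua hua3.ne
    (by linarith) hn hn1 hR (by rw [Matrix.det_diagonal, Fin.prod_univ_three]; simp only [Matrix.cons_val]; ring) heqa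
  obtain ⟨mb, pb⟩ := aux_curve s1 s2 s3 ub 0 m _ Rp hs1 hs12 hs23 hsum hub hub3.ne'
    (by linarith) hm hm1 hRp (by rw [Matrix.det_diagonal, Fin.prod_univ_three]; simp only [Matrix.cons_val]; ring) heqb
  refine ⟨ma, mb, ?_⟩
  intro t ht t' ht' e2 e3
  obtain ⟨a1, a2, a3⟩ := pa t ht
  obtain ⟨b1, b2, b3⟩ := pb t' ht'
  rw [← e2] at b2 b3
  rw [← e3] at b3
  have hal : ua / s2 < 1 := (div_lt_one hs2).2 hua3
  have hbl : 1 < ub / s2 := (one_lt_div hs2).2 hub3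
  have hal0 : 0 < ua / s2 := div_pos (by linarith) hs2
  have hea : etaFun (ua / s2) t ≤ 1 := by
    by_contra hc
    push Not at hc
    nlinarith
  have heb : 1 ≤ etaFun (ub / s2) t' := by
    by_contra hc
    push Not at hc
    nlinarith
  have hEq : etaFun (ua / s2) t = etaFun (ub / s2) t' := by
    by_contra hne
    generalize etaFun (ua / s2) t = x at *
    generalize etaFun (ub / s2) t' = y at *
    generalize i2 (Mcurve (Matrix.diagonal ![s1, s2, s3]) n (ua / s2) t) = I at *
    have hd : s2 * x - s2 * y ≠ 0 := by
      rw [← mul_sub]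
      exact mul_ne_zero hs2.ne' (sub_ne_zero.2 hne)
    have hr : (s2 * x) ^ 2 + (s2 * x) * (s2 * y) + (s2 * y) ^ 2 - (s2 * x + s2 * y) + I = 0 := by
      apply mul_left_cancel₀ hd
      linear_combination a3 - b3
    have : 0 < (s2 * x - s2 * y) ^ 2 := by positivity
    nlinarith
  exact ⟨aux_eta_zero _ hal0 hal.ne t ht (by linarith),
    aux_eta_zero _ (by linarith) hbl.ne' t' ht' (by linarith)⟩
end
end
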